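/- For every discount factor λ ∈ [0,1), every initial state s₀ ∈ S, every player i ∈ I, every partition 𝒟^i of the set of states, and every cutoff vector c^i ∈ ℝ^{𝒟^i}: overline-v̂^i_λ(s₀;𝒟^i,c^i) ≤ overline-v̂^i_{λ,stat}(s₀;𝒟^i,c^i) ≤ overline-v^i_λ(s₀); that is, the min-max value of player i in the modified game is at most the min-max value in stationary strategies of the modified game, which in turn is at most the λ-discounted min-max value of player i in the original stochastic game. -/

import Mathlib

open MeasureTheory Filter Topology
open scoped ENNReal

noncomputable section

/-- A finite stochastic game: a finite set of players `I`, a finite set of states `S`,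
finite nonempty action sets `A i s`, stage payoffs `u` bounded by `1` in absolute value,
and transition probabilities `q`. -/
structure StocGame where
  (I : Type)
  (S : Type)
  (A : I → S → Type)
  [fintypeI : Fintype I]
  [fintypeS : Fintype S]
  [decI : DecidableEq I]
  [decS : DecidableEq S]
  [fintypeA : ∀ i s, Fintype (A i s)]
  [decA : ∀ i s, DecidableEq (A i s)]
  [nonemptyA : ∀ i s, Nonempty (A i s)]
  (u : I → (s : S) → ((j : I) → A j s) → ℝ)
  (u_bdd : ∀ i s a, |u i s a| ≤ 1)
  (q : (s : S) → ((j : I) → A j s) → S → ℝ)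
  (q_nonneg : ∀ s a s', 0 ≤ q s a s')
  (q_sum : ∀ s a, ∑ s', q s a s' = 1)

namespace StocGame

attribute [instance] fintypeI fintypeS decI decS fintypeA decA nonemptyA

/-- A mixed action over a finite set of actions. -/
abbrev Mixed (α : Type) [Fintype α] : Type := {f : α → ℝ // (∀ a, 0 ≤ f a) ∧ ∑ a, f a = 1}

variable {G : StocGame}

/-- Action profiles available at state `s`. -/
abbrev Prof (G : StocGame) (s : G.S) : Type := (j : G.I) → G.A j s

/-- A pair of a state together with an action profile at that state. -/
abbrev Step (G : StocGame) : Type := Σ s : G.S, G.Prof s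

/-- A finite history: a (reversed) list of past (state, action profile) steps,
together with the current state. -/
abbrev Hist (G : StocGame) : Type := List G.Step × G.S

/-- A behavior strategy of player `i`. -/
abbrev BStrat (G : StocGame) (i : G.I) : Type := (h : G.Hist) → Mixed (G.A i h.2)

/-- A (behavior) strategy profile. -/
abbrev Profile (G : StocGame) : Type := (i : G.I) → G.BStrat i

/-- A stationary strategy of player `i`. -/
abbrev Stat (G : StocGame) (i : G.I) : Type := (s : G.S) → Mixed (G.A i s)

/-- A stationary strategy profile. -/
abbrev StatProf (G : StocGame) : Type := (i : G.I) → G.Stat i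

/-- The behavior strategy profile induced by a stationary strategy profile. -/
def toB (x : G.StatProf) : G.Profile := fun i h => x i h.2

/-- The behavior strategy induced by a stationary strategy. -/
def toB1 {i : G.I} (x : G.Stat i) : G.BStrat i := fun h => x h.2

/-- A stationary strategy profile is pure if at every state each player
puts probability `1` on a single action. -/
def IsPureStat (x : G.StatProf) : Prop :=
  ∀ (i : G.I) (s : G.S), ∃ a : G.A i s, ∀ b, (x i s).1 b = if b = a then 1 else 0

/-- The probability, under strategy profile `σ` and initial state `s0`, that the play follows
the finite history whose (reversed) list of steps is the first argument and whose current
state is the second argument. -/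
def probHistAux (s0 : G.S) (σ : G.Profile) : List G.Step → G.S → ℝ
  | [], s => if s = s0 then 1 else 0
  | ⟨s', a⟩ :: rest, s =>
      probHistAux s0 σ rest s' * (∏ i, (σ i (rest, s')).1 (a i)) * G.q s' a s

/-- The probability that the play follows the finite history `h`. -/
def probHist (s0 : G.S) (σ : G.Profile) (h : G.Hist) : ℝ := probHistAux s0 σ h.1 h.2

/-- The expected `lam`-discounted time `t_lam(s0,σ;s,a)` that the play spends at the
state-action pair `st = (s,a)`. -/
def tStep (lam : ℝ) (s0 : G.S) (σ : G.Profile) (st : G.Step) : ℝ :=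
  (1 - lam) *
    ∑' h : G.Hist, (if h.1.head? = some st then lam ^ (h.1.length - 1) * probHist s0 σ h else 0)

/-- The expected `lam`-discounted time that the play spends in the set of states `D`. -/
def tSet (lam : ℝ) (s0 : G.S) (σ : G.Profile) (D : Finset G.S) : ℝ :=
  ∑ st : G.Step, if st.1 ∈ D then tStep lam s0 σ st else 0

/-- The `lam`-discounted (unnormalized) payoff `U^i_lam(s0,σ;D)` that player `i` receives
while the play is in `D`. -/
def UD (lam : ℝ) (s0 : G.S) (σ : G.Profile) (i : G.I) (D : Finset G.S) : ℝ :=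
  ∑ st : G.Step, if st.1 ∈ D then tStep lam s0 σ st * G.u i st.1 st.2 else 0

/-- The `lam`-discounted payoff of player `i`. -/
def payoffD (lam : ℝ) (s0 : G.S) (σ : G.Profile) (i : G.I) : ℝ :=
  ∑ st : G.Step, tStep lam s0 σ st * G.u i st.1 st.2

/-- `Di` is a partition of the set of states. -/
def IsPartitionF (Di : Finset (Finset G.S)) : Prop :=
  ∀ s : G.S, ∃! D : Finset G.S, D ∈ Di ∧ s ∈ D

/-- The payoff of player `i` in the modified game, given the partition `Di` and
the cutoffs `c`. -/
def modPayoff (lam : ℝ) (s0 : G.S) (σ : G.Profile) (i : G.I)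
    (Di : Finset (Finset G.S)) (c : Finset G.S → ℝ) : ℝ :=
  ∑ D ∈ Di, min (UD lam s0 σ i D) (tSet lam s0 σ D * c D)

/-- The `lam`-discounted min-max value of player `i` in the original game. -/
def minmaxOrig (G : StocGame) (lam : ℝ) (s0 : G.S) (i : G.I) : ℝ :=
  ⨅ σ : G.Profile, ⨆ σi : G.BStrat i, payoffD lam s0 (Function.update σ i σi) i

/-- The `lam`-discounted max-min value of player `i` in the original game. -/
def maxminOrig (G : StocGame) (lam : ℝ) (s0 : G.S) (i : G.I) : ℝ :=
  ⨆ σi : G.BStrat i, ⨅ σ : G.Profile, payoffD lam s0 (Function.update σ i σi) i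

/-- The min-max value of player `i` in the modified game. -/
def minmaxMod (G : StocGame) (lam : ℝ) (s0 : G.S) (i : G.I)
    (Di : Finset (Finset G.S)) (c : Finset G.S → ℝ) : ℝ :=
  ⨅ σ : G.Profile, ⨆ σi : G.BStrat i,
    modPayoff lam s0 (Function.update σ i σi) i Di c

/-- The max-min value of player `i` in the modified game. -/
def maxminMod (G : StocGame) (lam : ℝ) (s0 : G.S) (i : G.I)
    (Di : Finset (Finset G.S)) (c : Finset G.S → ℝ) : ℝ :=
  ⨆ σi : G.BStrat i, ⨅ σ : G.Profile,
    modPayoff lam s0 (Function.update σ i σi) i Di c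

/-- The min-max value in stationary strategies of player `i` in the modified game. -/
def minmaxModStat (G : StocGame) (lam : ℝ) (s0 : G.S) (i : G.I)
    (Di : Finset (Finset G.S)) (c : Finset G.S → ℝ) : ℝ :=
  ⨅ x : G.StatProf, ⨆ xi : G.Stat i,
    modPayoff lam s0 (Function.update (toB x) i (toB1 xi)) i Di c

/-- The max-min value in stationary strategies of player `i` in the modified game. -/
def maxminModStat (G : StocGame) (lam : ℝ) (s0 : G.S) (i : G.I)
    (Di : Finset (Finset G.S)) (c : Finset G.S → ℝ) : ℝ :=
  ⨆ xi : G.Stat i, ⨅ x : G.StatProf,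
    modPayoff lam s0 (Function.update (toB x) i (toB1 xi)) i Di c

/-! ### Plays and the induced measure -/

/-- A play: the infinite sequence of (state, action profile) pairs. -/
abbrev Play (G : StocGame) : Type := ℕ → G.Step

instance : MeasurableSpace G.Step := ⊤

/-- The finite history consisting of the first `n` stages of the play `p`
(reversed list of the first `n` steps, together with the state at stage `n`). -/
def histOf (p : G.Play) : ℕ → G.Hist
  | 0 => ([], (p 0).1)
  | n + 1 => ((p n) :: (histOf p n).1, (p (n + 1)).1)

/-- The cylinder set of plays whose initial segment is the finite history `h`. -/
def cylSet (h : G.Hist) : Set G.Play := {p | histOf p h.1.length = h}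

/-- `μfam` is the family of probability measures on plays induced (via the
Ionescu–Tulcea theorem) by the initial state and the strategy profile:
it is characterized by being a probability measure giving each cylinder set
the probability of the corresponding finite history. -/
def IsInduced (μfam : G.S → G.Profile → Measure G.Play) : Prop :=
  (∀ s0 σ, IsProbabilityMeasure (μfam s0 σ)) ∧
  ∀ (s0 : G.S) (σ : G.Profile) (h : G.Hist),
    μfam s0 σ (cylSet h) = ENNReal.ofReal (probHist s0 σ h)

/-- A bounded stopping time (with respect to the filtration generated by finite histories). -/
def IsBddST (τ : G.Play → ℕ) : Prop :=
  (∃ B, ∀ p, τ p ≤ B) ∧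
  ∀ p p' n, τ p = n → histOf p n = histOf p' n → τ p' = n

/-- Two states lie in the same element of the partition `Di`. -/
def sameOf (Di : Finset (Finset G.S)) (s s' : G.S) : Prop := ∃ D ∈ Di, s ∈ D ∧ s' ∈ D

open Classical in
/-- The number of switches between elements of a partition along a play,
where the partition is described through the relation `r` ("being in the same element"). -/
def Zsw (r : G.S → G.S → Prop) (p : G.Play) : ℝ≥0∞ :=
  ∑' n : ℕ, if r (p n).1 (p (n + 1)).1 then 0 else 1

/-- The stopping times `τ^𝒟_k` indicating when the play moves from one element of
the partition (described by the relation `r`) to another. -/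
def switchT (r : G.S → G.S → Prop) (p : G.Play) : ℕ → ℕ∞
  | 0 => 0
  | k + 1 => sInf {n : ℕ∞ | ∃ m : ℕ, n = (m : ℕ∞) ∧ switchT r p k < (m : ℕ∞) ∧
      ¬ r (p (m - 1)).1 (p m).1}

/-- The expected average payoff of player `i` in the `N`-stage game. -/
def payoffN (μfam : G.S → G.Profile → Measure G.Play) (N : ℕ) (s0 : G.S)
    (σ : G.Profile) (i : G.I) : ℝ :=
  (∫ p, (∑ n ∈ Finset.range N, G.u i (p n).1 (p n).2) ∂(μfam s0 σ)) / N

/-- `σi` is a uniform `ε`-max-min strategy of player `i` (with respect to the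
uniform max-min value function `v`). -/
def UnifMaxMin (μfam : G.S → G.Profile → Measure G.Play) (v : G.S → ℝ) (i : G.I)
    (σi : G.BStrat i) (ε : ℝ) : Prop :=
  ∃ lam0 : ℝ, 0 ≤ lam0 ∧ lam0 < 1 ∧ ∃ N0 : ℕ,
    ∀ (s0 : G.S) (σ : G.Profile),
      (∀ lam : ℝ, lam0 < lam → lam < 1 →
        v s0 - ε ≤ payoffD lam s0 (Function.update σ i σi) i) ∧
      (∀ τ : G.Play → ℕ, IsBddST τ →
        (N0 : ℝ) ≤ ∫ p, (τ p : ℝ) ∂(μfam s0 (Function.update σ i σi)) →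
        (v s0 - ε) * ∫ p, (τ p : ℝ) ∂(μfam s0 (Function.update σ i σi)) ≤
          ∫ p, (∑ n ∈ Finset.range (τ p), G.u i (p n).1 (p n).2)
            ∂(μfam s0 (Function.update σ i σi)))

/-- `σi` is `(𝒟,ε)`-max-min preserving, where the partition `𝒟` is described by the
relation `r`, and the conditional-expectation requirement is expressed through
integrals over the atoms (cylinder sets) of the σ-algebra of the stopping time `τ^𝒟_k`. -/
def PreservingPart (μfam : G.S → G.Profile → Measure G.Play) (v : G.S → ℝ)
    (r : G.S → G.S → Prop) (i : G.I) (σi : G.BStrat i) (ε : ℝ) : Prop :=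
  ∀ (s0 : G.S) (σ : G.Profile) (k : ℕ) (τ' : G.Play → ℕ), IsBddST τ' →
    (∀ p, switchT r p k ≠ ⊤ →
      switchT r p k < (τ' p : ℕ∞) ∧ (τ' p : ℕ∞) ≤ switchT r p (k + 1)) →
    ∀ h : G.Hist, (∀ p ∈ cylSet h, switchT r p k = (h.1.length : ℕ∞)) →
      ∫ p in cylSet h, (v h.2 - ε) ∂(μfam s0 (Function.update σ i σi)) ≤
        ∫ p in cylSet h, v ((p (τ' p)).1) ∂(μfam s0 (Function.update σ i σi))

/-- `σi` is `ε`-max-min preserving (with respect to arbitrary bounded stopping times);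
again the conditional-expectation requirement is expressed through integrals over the
atoms of the σ-algebra of the stopping time `τ`. -/
def PreservingST (μfam : G.S → G.Profile → Measure G.Play) (v : G.S → ℝ) (i : G.I)
    (σi : G.BStrat i) (ε : ℝ) : Prop :=
  ∀ (s0 : G.S) (σ : G.Profile) (τ τ' : G.Play → ℕ), IsBddST τ → IsBddST τ' →
    (∀ p, τ p < τ' p) →
    ∀ h : G.Hist, (∀ p ∈ cylSet h, τ p = h.1.length) →
      ∫ p in cylSet h, (v h.2 - ε) ∂(μfam s0 (Function.update σ i σi)) ≤
        ∫ p in cylSet h, v ((p (τ' p)).1) ∂(μfam s0 (Function.update σ i σi))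

/-- A history enters a new element of the partition (described by `r`) at its final stage. -/
def entersNew (r : G.S → G.S → Prop) (h : G.Hist) : Prop :=
  match h.1 with
  | [] => True
  | st :: _ => ¬ r st.1 h.2

/-- `σi` is `𝒟`-Markovian: its continuation strategy coincides after any two finite histories
that end at the same state and whose final stage enters a new element of the partition
(described by `r`). -/
def Markovian (r : G.S → G.S → Prop) {i : G.I} (σi : G.BStrat i) : Prop :=
  ∀ h h' : G.Hist, h.2 = h'.2 → entersNew r h → entersNew r h' →
    ∀ (l : List G.Step) (s'' : G.S), σi (l ++ h.1, s'') = σi (l ++ h'.1, s'')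

open Classical in
/-- The portion of the history since the last time the play entered a new element of the
partition (described by `r`): (reversed) list of steps, given the current state. -/
def philist (r : G.S → G.S → Prop) : List G.Step → G.S → List G.Step
  | [], _ => []
  | st :: rest, s => if r st.1 s then st :: philist r rest st.1 else []

/-- The restart strategy `σ^i_𝒟`: whenever the play enters a new element of the partition
(described by `r`), player `i` forgets past play and restarts playing `σi`. -/
def restart {i : G.I} (σi : G.BStrat i) (r : G.S → G.S → Prop) : G.BStrat i :=
  fun h => σi (philist r h.1 h.2, h.2)

/-- The partition `Di` satisfies Property P with respect to player `i`
(whose uniform max-min value function is `v`). -/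
def PropertyP (μfam : G.S → G.Profile → Measure G.Play) (v : G.S → ℝ) (i : G.I)
    (Di : Finset (Finset G.S)) : Prop :=
  ∃ ζ : ℝ, 0 < ζ ∧ ∀ ε : ℝ, 0 < ε → ∃ σi : G.BStrat i,
    Markovian (sameOf Di) σi ∧ UnifMaxMin μfam v i σi ε ∧
    ∀ (s0 : G.S) (σ : G.Profile), ∃ E : Set G.Play,
      ENNReal.ofReal (1 - ε) < μfam s0 (Function.update σ i σi) E ∧
      ∫⁻ p in E, Zsw (sameOf Di) p ∂(μfam s0 (Function.update σ i σi)) ≤ ENNReal.ofReal ζ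

/-- The strategy profile `σ` (whose `i`-th coordinate is the strategy of player `i`) makes
player `i`'s strategy a uniform `𝒟`-subgame-perfect `ε`-min-max strategy against the others'
strategies, at the initial state `s0`; `vbar` is the uniform min-max value function of
player `i`, and the partition `𝒟` is described by the relation `r`.  Conditional-expectation
requirements are expressed through integrals over the atoms (cylinder sets) of the σ-algebra
of the stopping time `τ^𝒟_k`. -/
def SubgamePerfect (μfam : G.S → G.Profile → Measure G.Play) (vbar : G.S → ℝ)
    (r : G.S → G.S → Prop) (i : G.I) (σ : G.Profile) (s0 : G.S) (ε : ℝ) : Prop :=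
  ∃ N0 : ℕ, 0 < N0 ∧
    (∀ N : ℕ, N0 ≤ N → vbar s0 - ε ≤ payoffN μfam N s0 σ i) ∧
    (∀ (k : ℕ) (τ : G.Play → ℕ), IsBddST τ → (∀ p, switchT r p k ≤ (τ p : ℕ∞)) →
      ∀ h : G.Hist, (∀ p ∈ cylSet h, switchT r p k = (h.1.length : ℕ∞)) →
        (∫ p in cylSet h, (vbar h.2 - ε) ∂(μfam s0 σ) ≤
          ∫ p in cylSet h, vbar ((p (τ p)).1) ∂(μfam s0 σ)) ∧
        ((N0 : ℝ) * (μfam s0 σ (cylSet h)).toReal ≤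
            ∫ p in cylSet h, ((τ p : ℝ) - (h.1.length : ℝ)) ∂(μfam s0 σ) →
          (vbar h.2 - ε) * ∫ p in cylSet h, ((τ p : ℝ) - (h.1.length : ℝ)) ∂(μfam s0 σ) ≤
            ∫ p in cylSet h, (∑ n ∈ Finset.Ico h.1.length (τ p), G.u i (p n).1 (p n).2)
              ∂(μfam s0 σ)))

/-- The partition `Di` satisfies Property P' with respect to player `i`
(whose uniform min-max value function is `vbar`). -/
def PropertyP' (μfam : G.S → G.Profile → Measure G.Play) (vbar : G.S → ℝ) (i : G.I)
    (Di : Finset (Finset G.S)) : Prop :=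
  ∃ ζ : ℝ, 0 < ζ ∧ ∀ ε : ℝ, 0 < ε → ∀ (s0 : G.S) (σ : G.Profile), ∃ σi : G.BStrat i,
    SubgamePerfect μfam vbar (sameOf Di) i (Function.update σ i σi) s0 ε ∧
    ∃ E : Set G.Play,
      ENNReal.ofReal (1 - ε) ≤ μfam s0 (Function.update σ i σi) E ∧
      ∫⁻ p in E, Zsw (sameOf Di) p ∂(μfam s0 (Function.update σ i σi)) ≤ ENNReal.ofReal ζ

/-! ### Reachability, closed and strongly controllable sets -/

/-- The first arrival time to the set of states `C`. -/
def hitT (C : Set G.S) (p : G.Play) : ℕ∞ :=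
  sInf {n : ℕ∞ | ∃ m : ℕ, n = (m : ℕ∞) ∧ (p m).1 ∈ C}

/-- State `s` leads in `D` to state `s'`. -/
def LeadsIn (μfam : G.S → G.Profile → Measure G.Play) (D : Set G.S) (s s' : G.S) : Prop :=
  ∃ σ : G.Profile, μfam s σ {p | hitT {s'} p < hitT Dᶜ p} = 1

/-- The states `s` and `s'` are `D`-siblings. -/
def Siblings (μfam : G.S → G.Profile → Measure G.Play) (D : Set G.S) (s s' : G.S) : Prop :=
  LeadsIn μfam D s s' ∧ LeadsIn μfam D s' s

/-- The probability `q(D | s, a)` that the next state lies in `D`. -/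
def qOf (D : Set G.S) (s : G.S) (a : G.Prof s) : ℝ := ∑ s', D.indicator (G.q s a) s'

/-- The set of states `D` is closed. -/
def ClosedSet (G : StocGame) (D : Set G.S) : Prop :=
  ∀ s ∈ D, ∀ a : G.Prof s, qOf D s a = 1

/-- The set of states `D` is strongly controllable. -/
def StronglyContr (G : StocGame) (D : Set G.S) : Prop :=
  ∃ iD : G.I, ∃ sD ∈ D, ∃ atil : G.A iD sD,
    ∀ s ∈ D, ∀ a : G.Prof s, qOf D s a < 1 → s = sD ∧ HEq (a iD) atil

/-- The element of the partition `𝒟` (by the vector of uniform min-max values `v`)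
that contains the state `s`. -/
def Dv (v : G.I → G.S → ℝ) (s : G.S) : Set G.S := {s' | ∀ i, v i s' = v i s}

/-- The element of the refined partition `𝒟*` (refining `𝒟` by the `D`-siblings relation)
that contains the state `s`. -/
def DstarCl (μfam : G.S → G.Profile → Measure G.Play) (v : G.I → G.S → ℝ) (s : G.S) :
    Set G.S := {s' | s' ∈ Dv v s ∧ Siblings μfam (Dv v s) s s'}

/-- The stochastic game is strongly controllable: every element of `𝒟*` is either closed
or strongly controllable. -/
def StronglyControllableGame (G : StocGame) (μfam : G.S → G.Profile → Measure G.Play)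
    (v : G.I → G.S → ℝ) : Prop :=
  ∀ s : G.S, ClosedSet G (DstarCl μfam v s) ∨ StronglyContr G (DstarCl μfam v s)

end StocGame

/-- A set `X ⊆ ℝ^ι` is monovex if every two points of `X` are connected by a continuous
path inside `X` all of whose coordinates are monotone. -/
def Monovex {ι : Type} (X : Set (ι → ℝ)) : Prop :=
  ∀ x ∈ X, ∀ y ∈ X, ∃ f : ℝ → ι → ℝ,
    ContinuousOn f (Set.Icc 0 1) ∧ (∀ t ∈ Set.Icc (0 : ℝ) 1, f t ∈ X) ∧
    f 0 = x ∧ f 1 = y ∧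
    ∀ j : ι, MonotoneOn (fun t => f t j) (Set.Icc 0 1) ∨
      AntitoneOn (fun t => f t j) (Set.Icc 0 1)

end

namespace StocGame

variable {G : StocGame}

/-! ### Summation over finite histories -/

/-- The probability that the profile `σ` plays `a` after the history `h`. -/
def actProb (σ : G.Profile) (h : G.Hist) (a : G.Prof h.2) : ℝ := ∏ j, (σ j h).1 (a j)

lemma actProb_nonneg (σ : G.Profile) (h : G.Hist) (a : G.Prof h.2) : 0 ≤ actProb σ h a :=
  Finset.prod_nonneg fun j _ => (σ j h).2.1 _

lemma sum_prod_mixed {s : G.S} (y : ∀ j, Mixed (G.A j s)) :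
    ∑ a : G.Prof s, ∏ j, (y j).1 (a j) = 1 := by
  rw [← Fintype.prod_sum (fun j b => (y j).1 b)]
  exact Finset.prod_eq_one fun j _ => (y j).2.2

lemma sum_actProb (σ : G.Profile) (h : G.Hist) : ∑ a, actProb σ h a = 1 :=
  sum_prod_mixed fun j => σ j h

/-- The history `h` extended by the profile `a` and the new state `s`. -/
def extend (h : G.Hist) (a : G.Prof h.2) (s : G.S) : G.Hist := (⟨h.2, a⟩ :: h.1, s)

lemma probHist_nil (s0 : G.S) (σ : G.Profile) (s : G.S) :
    probHist s0 σ ([], s) = if s = s0 then 1 else 0 := rfl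

lemma probHist_extend (s0 : G.S) (σ : G.Profile) (h : G.Hist) (a : G.Prof h.2) (s : G.S) :
    probHist s0 σ (extend h a s) = probHist s0 σ h * actProb σ h a * G.q h.2 a s := rfl

lemma probHist_nonneg (s0 : G.S) (σ : G.Profile) (h : G.Hist) : 0 ≤ probHist s0 σ h := by
  obtain ⟨l, s⟩ := h
  induction l generalizing s with
  | nil => rw [probHist_nil]; split_ifs <;> norm_num
  | cons st l ih =>
    exact mul_nonneg (mul_nonneg (ih st.1) (actProb_nonneg σ (l, st.1) st.2)) (G.q_nonneg _ _ _)

/-- A history is either an initial state or the one-stage extension of a history. -/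
def histEquiv (G : StocGame) : G.S ⊕ (Σ h : G.Hist, G.Prof h.2 × G.S) ≃ G.Hist where
  toFun
    | .inl s => ([], s)
    | .inr p => extend p.1 p.2.1 p.2.2
  invFun
    | ([], s) => .inl s
    | (⟨s', a⟩ :: l, s) => .inr ⟨(l, s'), a, s⟩
  left_inv := by rintro (s | ⟨⟨l, s'⟩, a, s⟩) <;> rfl
  right_inv := by rintro ⟨_ | ⟨⟨s', a⟩, l⟩, s⟩ <;> rfl

lemma tsum_hist {f : G.Hist → ℝ} (hf : Summable f) :
    ∑' h, f h = ∑ s, f ([], s) + ∑' h, ∑ a, ∑ s, f (extend h a s) := by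
  have hf' : Summable (f ∘ histEquiv G) := (histEquiv G).summable_iff.2 hf
  have h2 : Summable ((f ∘ histEquiv G) ∘ Sum.inr) := hf'.comp_injective Sum.inr_injective
  rw [← (histEquiv G).tsum_eq f]
  refine (Summable.tsum_sum (f := f ∘ histEquiv G)
    (hf'.comp_injective Sum.inl_injective) h2).trans ?_
  rw [tsum_fintype]
  congr 1
  refine (Summable.tsum_sigma h2).trans (tsum_congr fun h => ?_)
  rw [tsum_fintype, Fintype.sum_prod_type]
  rfl

lemma summable_hist_of_nonneg {f : G.Hist → ℝ} (h0 : ∀ h, 0 ≤ f h)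
    (hf : Summable fun h => ∑ a, ∑ s, f (extend h a s)) : Summable f := by
  rw [← (histEquiv G).summable_iff]
  refine Summable.sum _ Summable.of_finite ?_
  refine (summable_sigma_of_nonneg fun _ => h0 _).2 ⟨fun _ => Summable.of_finite, ?_⟩
  refine hf.congr fun h => ?_
  rw [tsum_fintype, Fintype.sum_prod_type]
  rfl

/-- The discounted weight of a finite history. -/
def weight (lam : ℝ) (s0 : G.S) (σ : G.Profile) (h : G.Hist) : ℝ :=
  lam ^ h.1.length * probHist s0 σ h

variable {lam : ℝ} {s0 : G.S} {σ : G.Profile}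

lemma weight_nonneg (hlam0 : 0 ≤ lam) (h : G.Hist) : 0 ≤ weight lam s0 σ h :=
  mul_nonneg (pow_nonneg hlam0 _) (probHist_nonneg _ _ _)

lemma weight_extend (h : G.Hist) (a : G.Prof h.2) (s : G.S) :
    weight lam s0 σ (extend h a s) = lam * weight lam s0 σ h * actProb σ h a * G.q h.2 a s := by
  simp only [weight, probHist_extend]
  simp only [extend, List.length_cons, pow_succ]
  ring

lemma sum_weight_extend (h : G.Hist) :
    ∑ a, ∑ s, weight lam s0 σ (extend h a s) = lam * weight lam s0 σ h := by
  simp only [weight_extend, ← Finset.mul_sum, G.q_sum, mul_one, sum_actProb]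

lemma sum_weight_nil : ∑ s, weight lam s0 σ ([], s) = 1 := by
  simp [weight, probHist_nil]

lemma summable_truncated (f : G.Hist → ℝ) (n : ℕ) :
    Summable fun h : G.Hist => if h.1.length < n then f h else 0 := by
  refine summable_of_hasFiniteSupport
    (((List.finite_length_lt G.Step n).prod (Set.finite_univ (α := G.S))).subset ?_)
  intro h hh
  refine ⟨?_, trivial⟩
  by_contra hn
  exact hh (if_neg hn)

lemma tsum_truncated_weight_le (hlam0 : 0 ≤ lam) (hlam1 : lam < 1) (n : ℕ) :
    ∑' h : G.Hist, (if h.1.length < n then weight lam s0 σ h else 0) ≤ 1 / (1 - lam) := by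
  have hpos : 0 < 1 - lam := by linarith
  induction n with
  | zero => simpa using hpos.le
  | succ n ih =>
    rw [tsum_hist (summable_truncated _ _)]
    have : ∀ h : G.Hist, (∑ a, ∑ s, (if (extend h a s).1.length < n + 1
        then weight lam s0 σ (extend h a s) else 0)) =
        lam * (if h.1.length < n then weight lam s0 σ h else 0) := by
      intro h
      simp only [extend, List.length_cons, add_lt_add_iff_right]
      split_ifs
      · exact sum_weight_extend h
      · simp
    simp only [this, tsum_mul_left, List.length_nil, Nat.succ_pos, if_true, sum_weight_nil]
    calc _ ≤ 1 + lam * (1 / (1 - lam)) := by gcongr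
      _ = 1 / (1 - lam) := by field_simp; ring

lemma summable_weight (hlam0 : 0 ≤ lam) (hlam1 : lam < 1) : Summable (weight lam s0 σ) := by
  refine summable_of_sum_le (c := 1 / (1 - lam)) (fun h => weight_nonneg hlam0 h) fun u => ?_
  refine le_trans ?_ (tsum_truncated_weight_le (s0 := s0) (σ := σ) hlam0 hlam1
    (u.sup (fun h => h.1.length) + 1))
  refine le_trans (le_of_eq ?_) ((summable_truncated _ _).sum_le_tsum u fun h _ => ?_)
  · refine Finset.sum_congr rfl fun h hh => ?_
    rw [if_pos (Nat.lt_succ_of_le (Finset.le_sup (f := fun h : G.Hist => h.1.length) hh))]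
  · split_ifs
    exacts [weight_nonneg hlam0 h, le_rfl]

/-- The expected discounted sum of the values of `φ` along the play. -/
noncomputable def discSum (lam : ℝ) (s0 : G.S) (σ : G.Profile) (φ : G.Hist → ℝ) : ℝ :=
  ∑' h, weight lam s0 σ h * φ h

lemma summable_weight_mul (hlam0 : 0 ≤ lam) (hlam1 : lam < 1) {φ : G.Hist → ℝ} {C : ℝ}
    (hφ : ∀ h, |φ h| ≤ C) : Summable fun h => weight lam s0 σ h * φ h := by
  refine Summable.of_norm_bounded
    ((summable_weight (s0 := s0) (σ := σ) hlam0 hlam1).mul_right C) fun h => ?_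
  rw [Real.norm_eq_abs, abs_mul, abs_of_nonneg (weight_nonneg hlam0 h)]
  exact mul_le_mul_of_nonneg_left (hφ h) (weight_nonneg hlam0 h)

/-- The expected value of `w` at the next state after the history `h`. -/
def nextVal (σ : G.Profile) (w : G.S → ℝ) (h : G.Hist) : ℝ :=
  ∑ a, actProb σ h a * ∑ s, G.q h.2 a s * w s

/-- One-stage recursion for the discounted sum of a function of the state. -/
lemma discSum_state (hlam0 : 0 ≤ lam) (hlam1 : lam < 1) (w : G.S → ℝ) :
    discSum lam s0 σ (fun h => w h.2) = w s0 + lam * discSum lam s0 σ (nextVal σ w) := by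
  have hw : ∀ h : G.Hist, |w h.2| ≤ ∑ s, |w s| := fun h =>
    Finset.single_le_sum (f := fun s => |w s|) (fun _ _ => abs_nonneg _) (Finset.mem_univ h.2)
  rw [discSum, tsum_hist (summable_weight_mul hlam0 hlam1 hw)]
  congr 1
  · simp [weight, probHist_nil]
  · rw [discSum, ← tsum_mul_left]
    refine tsum_congr fun h => ?_
    simp only [weight_extend, nextVal, Finset.mul_sum]
    refine Finset.sum_congr rfl fun a _ => Finset.sum_congr rfl fun s _ => ?_
    simp only [extend]
    ring

lemma discSum_const (hlam0 : 0 ≤ lam) (hlam1 : lam < 1) (C : ℝ) :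
    discSum lam s0 σ (fun _ => C) = C / (1 - lam) := by
  have hpos : 1 - lam ≠ 0 := by linarith
  have h := discSum_state (s0 := s0) (σ := σ) hlam0 hlam1 (fun _ => C)
  have h2 : nextVal σ (fun _ => C) = fun _ => C := by
    funext h
    simp only [nextVal, ← Finset.sum_mul, G.q_sum, sum_actProb, one_mul]
  rw [h2] at h
  rw [eq_div_iff hpos]
  linarith

lemma discSum_mono (hlam0 : 0 ≤ lam) (hlam1 : lam < 1) {φ ψ : G.Hist → ℝ} {C D : ℝ}
    (hφ : ∀ h, |φ h| ≤ C) (hψ : ∀ h, |ψ h| ≤ D) (h : ∀ h, φ h ≤ ψ h) :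
    discSum lam s0 σ φ ≤ discSum lam s0 σ ψ :=
  (summable_weight_mul hlam0 hlam1 hφ).tsum_le_tsum
    (fun k => mul_le_mul_of_nonneg_left (h k) (weight_nonneg hlam0 k))
    (summable_weight_mul hlam0 hlam1 hψ)

lemma discSum_finset_sum {ι : Type*} (u : Finset ι) (hlam0 : 0 ≤ lam) (hlam1 : lam < 1)
    {φ : ι → G.Hist → ℝ} {C : ℝ} (hφ : ∀ k h, |φ k h| ≤ C) (c : ι → ℝ) :
    discSum lam s0 σ (fun h => ∑ k ∈ u, φ k h * c k) =
      ∑ k ∈ u, discSum lam s0 σ (φ k) * c k := by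
  simp only [discSum, Finset.mul_sum, ← tsum_mul_right, ← mul_assoc]
  exact Summable.tsum_finsetSum fun k _ => (summable_weight_mul hlam0 hlam1 (hφ k)).mul_right _

/-- The conditional probability, given the history `h`, that the current
state-action pair is `st`. -/
def pairProb (σ : G.Profile) (st : G.Step) (h : G.Hist) : ℝ :=
  ∑ a, if (⟨h.2, a⟩ : G.Step) = st then actProb σ h a else 0

lemma pairProb_nonneg (st : G.Step) (h : G.Hist) : 0 ≤ pairProb σ st h :=
  Finset.sum_nonneg fun a _ => by split_ifs; exacts [actProb_nonneg _ _ _, le_rfl]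

lemma pairProb_le_one (st : G.Step) (h : G.Hist) : pairProb σ st h ≤ 1 := by
  rw [← sum_actProb σ h]
  exact Finset.sum_le_sum fun a _ => by split_ifs; exacts [le_rfl, actProb_nonneg _ _ _]

lemma abs_pairProb_le (st : G.Step) (h : G.Hist) : |pairProb σ st h| ≤ 1 := by
  rw [abs_of_nonneg (pairProb_nonneg st h)]
  exact pairProb_le_one st h

lemma sum_pairProb_mul (h : G.Hist) (g : G.Step → ℝ) :
    ∑ st, pairProb σ st h * g st = ∑ a, actProb σ h a * g ⟨h.2, a⟩ := by
  simp only [pairProb, Finset.sum_mul, ite_mul, zero_mul]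
  rw [Finset.sum_comm]
  simp

lemma tStep_eq_discSum (hlam0 : 0 ≤ lam) (hlam1 : lam < 1) (st : G.Step) :
    tStep lam s0 σ st = (1 - lam) * discSum lam s0 σ (pairProb σ st) := by
  have key : ∀ h : G.Hist, (∑ a, ∑ s, (if (extend h a s).1.head? = some st then
      lam ^ ((extend h a s).1.length - 1) * probHist s0 σ (extend h a s) else 0)) =
      weight lam s0 σ h * pairProb σ st h := by
    intro h
    simp only [probHist_extend]
    simp only [extend, List.head?_cons, Option.some.injEq, List.length_cons,
      Nat.add_sub_cancel, pairProb, Finset.mul_sum, weight]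
    refine Finset.sum_congr rfl fun a _ => ?_
    split_ifs
    · simp only [← mul_assoc, ← Finset.mul_sum, G.q_sum, mul_one]
    · simp
  rw [tStep, discSum, tsum_hist]
  · simp only [key]
    simp
  · refine summable_hist_of_nonneg (fun h => ?_) ?_
    · split_ifs
      exacts [mul_nonneg (pow_nonneg hlam0 _) (probHist_nonneg _ _ _), le_rfl]
    · simp only [key]
      exact summable_weight_mul hlam0 hlam1 (abs_pairProb_le st)

lemma tStep_nonneg (hlam0 : 0 ≤ lam) (hlam1 : lam < 1) (st : G.Step) :
    0 ≤ tStep lam s0 σ st := by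
  rw [tStep_eq_discSum hlam0 hlam1]
  exact mul_nonneg (by linarith)
    (tsum_nonneg fun h => mul_nonneg (weight_nonneg hlam0 h) (pairProb_nonneg st h))

lemma tStep_le_one (hlam0 : 0 ≤ lam) (hlam1 : lam < 1) (st : G.Step) :
    tStep lam s0 σ st ≤ 1 := by
  have hpos : 0 < 1 - lam := by linarith
  rw [tStep_eq_discSum hlam0 hlam1]
  have h := discSum_mono (s0 := s0) (σ := σ) hlam0 hlam1 (abs_pairProb_le (σ := σ) st)
    (fun _ => (abs_one (α := ℝ)).le) (pairProb_le_one st)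
  rw [discSum_const hlam0 hlam1, le_div_iff₀ hpos] at h
  linarith

/-- The expected one-stage payoff after the history `h`. -/
def stagePay (σ : G.Profile) (i : G.I) (h : G.Hist) : ℝ :=
  ∑ a, actProb σ h a * G.u i h.2 a

lemma payoffD_eq_discSum (hlam0 : 0 ≤ lam) (hlam1 : lam < 1) (i : G.I) :
    payoffD lam s0 σ i = (1 - lam) * discSum lam s0 σ (stagePay σ i) := by
  have : stagePay σ i = fun h => ∑ st, pairProb σ st h * G.u i st.1 st.2 := by
    funext h
    exact (sum_pairProb_mul h fun st => G.u i st.1 st.2).symm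
  rw [this, discSum_finset_sum Finset.univ hlam0 hlam1 abs_pairProb_le, Finset.mul_sum, payoffD]
  simp only [tStep_eq_discSum hlam0 hlam1, mul_assoc]


/-! ### Stationary replies and occupation measures -/

/-- The expected discounted time spent in the state `s`, up to the factor `1 - lam`. -/
noncomputable def occ (lam : ℝ) (s0 : G.S) (σ : G.Profile) (s : G.S) : ℝ :=
  discSum lam s0 σ fun h => if h.2 = s then 1 else 0

lemma pairProb_eq (st : G.Step) (h : G.Hist) :
    pairProb σ st h =
      if h.2 = st.1 then ∏ j, (σ j (h.1, st.1)).1 (st.2 j) else 0 := by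
  obtain ⟨s, a⟩ := st
  obtain ⟨l, s'⟩ := h
  by_cases hs : s' = s
  · subst hs
    simp [pairProb, actProb]
  · simp [pairProb, hs]

/-- If the occupation measure of `σ` disintegrates along the stationary profile `y`, then the
occupation of the states satisfies the flow equation of `y`. -/
lemma occ_flow (hlam0 : 0 ≤ lam) (hlam1 : lam < 1) {y : G.StatProf}
    (hy : ∀ st : G.Step, discSum lam s0 σ (pairProb σ st) =
      occ lam s0 σ st.1 * ∏ j, (y j st.1).1 (st.2 j)) (s' : G.S) :
    occ lam s0 σ s' = (if s0 = s' then 1 else 0) +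
      lam * ∑ s, occ lam s0 σ s * ∑ a : G.Prof s, (∏ j, (y j s).1 (a j)) * G.q s a s' := by
  have h := discSum_state (s0 := s0) (σ := σ) hlam0 hlam1 (fun s => if s = s' then (1 : ℝ) else 0)
  have h2 : nextVal σ (fun s => if s = s' then (1 : ℝ) else 0) =
      fun h => ∑ st, pairProb σ st h * G.q st.1 st.2 s' := by
    funext h
    rw [sum_pairProb_mul h fun st => G.q st.1 st.2 s']
    simp [nextVal]
  rw [h2, discSum_finset_sum Finset.univ hlam0 hlam1 abs_pairProb_le] at h
  rw [occ, h]
  congr 2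
  rw [Fintype.sum_sigma]
  simp only [hy, Finset.mul_sum, mul_assoc]

lemma flow_unique (hlam0 : 0 ≤ lam) (hlam1 : lam < 1) {P : G.S → G.S → ℝ}
    (hP0 : ∀ s s', 0 ≤ P s s') (hP1 : ∀ s, ∑ s', P s s' = 1) {b m m' : G.S → ℝ}
    (hm : ∀ s', m s' = b s' + lam * ∑ s, m s * P s s')
    (hm' : ∀ s', m' s' = b s' + lam * ∑ s, m' s * P s s') : m = m' := by
  have hd : ∀ s', |m s' - m' s'| ≤ lam * ∑ s, |m s - m' s| * P s s' := by
    intro s'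
    have : m s' - m' s' = lam * ∑ s, (m s - m' s) * P s s' := by
      simp only [sub_mul, Finset.sum_sub_distrib]
      linarith [hm s', hm' s']
    rw [this, abs_mul, abs_of_nonneg hlam0]
    gcongr
    refine (Finset.abs_sum_le_sum_abs _ _).trans (le_of_eq ?_)
    simp only [abs_mul, abs_of_nonneg (hP0 _ _)]
  have hsum : ∑ s, |m s - m' s| ≤ lam * ∑ s, |m s - m' s| := by
    calc ∑ s', |m s' - m' s'| ≤ ∑ s', lam * ∑ s, |m s - m' s| * P s s' :=
          Finset.sum_le_sum fun s' _ => hd s'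
      _ = lam * ∑ s, |m s - m' s| := by
          rw [← Finset.mul_sum, Finset.sum_comm]
          simp only [← Finset.mul_sum, hP1, mul_one]
  have h0 : ∑ s, |m s - m' s| = 0 := by
    have hnn : 0 ≤ ∑ s, |m s - m' s| := Finset.sum_nonneg fun _ _ => abs_nonneg _
    nlinarith
  funext s
  have := (Finset.sum_eq_zero_iff_of_nonneg fun _ _ => abs_nonneg _).1 h0 s (Finset.mem_univ s)
  linarith [abs_eq_zero.1 this]

lemma discSum_pairProb_toB (y : G.StatProf) (st : G.Step) :
    discSum lam s0 (toB y) (pairProb (toB y) st) =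
      occ lam s0 (toB y) st.1 * ∏ j, (y j st.1).1 (st.2 j) := by
  rw [occ, discSum, discSum, ← tsum_mul_right]
  refine tsum_congr fun h => ?_
  rw [pairProb_eq]
  split_ifs <;> simp [toB]

lemma tStep_eq_of_disintegration (hlam0 : 0 ≤ lam) (hlam1 : lam < 1) {y : G.StatProf}
    (hy : ∀ st : G.Step, discSum lam s0 σ (pairProb σ st) =
      occ lam s0 σ st.1 * ∏ j, (y j st.1).1 (st.2 j)) :
    tStep lam s0 σ = tStep lam s0 (toB y) := by
  have hocc : occ lam s0 σ = occ lam s0 (toB y) := by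
    refine flow_unique hlam0 hlam1
      (P := fun s s' => ∑ a : G.Prof s, (∏ j, (y j s).1 (a j)) * G.q s a s')
      (fun s s' => Finset.sum_nonneg fun a _ =>
        mul_nonneg (Finset.prod_nonneg fun j _ => (y j s).2.1 _) (G.q_nonneg _ _ _))
      (fun s => ?_) (occ_flow hlam0 hlam1 hy)
      (occ_flow hlam0 hlam1 (discSum_pairProb_toB y))
    rw [Finset.sum_comm]
    simp only [← Finset.mul_sum, G.q_sum, mul_one]
    exact sum_prod_mixed fun j => y j s
  funext st
  rw [tStep_eq_discSum hlam0 hlam1, tStep_eq_discSum hlam0 hlam1, hy, discSum_pairProb_toB, hocc]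

lemma Mixed.le_one {α : Type} [Fintype α] (y : Mixed α) (b : α) : y.1 b ≤ 1 :=
  (Finset.single_le_sum (fun a _ => y.2.1 a) (Finset.mem_univ b)).trans_eq y.2.2

/-- The expected discounted number of times player `i` plays `b` at the state `s` when using
the behavior strategy `σi`. -/
noncomputable def actOcc (lam : ℝ) (s0 : G.S) (σ : G.Profile) {i : G.I} (σi : G.BStrat i)
    (s : G.S) (b : G.A i s) : ℝ :=
  discSum lam s0 σ fun h => if h.2 = s then (σi (h.1, s)).1 b else 0

lemma abs_actOcc_integrand_le {i : G.I} (σi : G.BStrat i) (s : G.S) (b : G.A i s) (h : G.Hist) :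
    |if h.2 = s then (σi (h.1, s)).1 b else 0| ≤ 1 := by
  split_ifs
  · rw [abs_of_nonneg ((σi (h.1, s)).2.1 b)]
    exact Mixed.le_one _ b
  · simp

lemma actOcc_nonneg (hlam0 : 0 ≤ lam) {i : G.I} (σi : G.BStrat i) (s : G.S) (b : G.A i s) :
    0 ≤ actOcc lam s0 σ σi s b :=
  tsum_nonneg fun h => mul_nonneg (weight_nonneg hlam0 h) (by
    dsimp only
    split_ifs
    exacts [(σi (h.1, s)).2.1 b, le_rfl])

lemma sum_actOcc (hlam0 : 0 ≤ lam) (hlam1 : lam < 1) {i : G.I} (σi : G.BStrat i) (s : G.S) :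
    ∑ b, actOcc lam s0 σ σi s b = occ lam s0 σ s := by
  have h := discSum_finset_sum (s0 := s0) (σ := σ) Finset.univ hlam0 hlam1
    (abs_actOcc_integrand_le σi s) (fun _ => 1)
  simp only [mul_one] at h
  simp only [actOcc, ← h, occ]
  congr 1
  funext h
  split_ifs
  · exact (σi (h.1, s)).2.2
  · simp

lemma exists_stat_actOcc (hlam0 : 0 ≤ lam) (hlam1 : lam < 1) {i : G.I} (σi : G.BStrat i) :
    ∃ xi : G.Stat i, ∀ s b, actOcc lam s0 σ σi s b = occ lam s0 σ s * (xi s).1 b := by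
  have key : ∀ s, ∃ y : Mixed (G.A i s), ∀ b,
      actOcc lam s0 σ σi s b = occ lam s0 σ s * y.1 b := by
    intro s
    have hsum := sum_actOcc (s0 := s0) (σ := σ) hlam0 hlam1 σi s
    by_cases hm : occ lam s0 σ s = 0
    · refine ⟨σi ([], s), fun b => ?_⟩
      rw [hm, zero_mul]
      rw [hm] at hsum
      exact (Finset.sum_eq_zero_iff_of_nonneg fun b _ => actOcc_nonneg hlam0 σi s b).1 hsum b
        (Finset.mem_univ b)
    · have hnn : 0 ≤ occ lam s0 σ s := by
        rw [← hsum]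
        exact Finset.sum_nonneg fun b _ => actOcc_nonneg hlam0 σi s b
      refine ⟨⟨fun b => actOcc lam s0 σ σi s b / occ lam s0 σ s,
        fun b => div_nonneg (actOcc_nonneg hlam0 σi s b) hnn, ?_⟩, fun b => ?_⟩
      · rw [← Finset.sum_div, hsum, div_self hm]
      · exact (mul_div_cancel₀ _ hm).symm
  choose xi hxi using key
  exact ⟨xi, hxi⟩

lemma toB_update (x : G.StatProf) {i : G.I} (xi : G.Stat i) :
    toB (Function.update x i xi) = Function.update (toB x) i (toB1 xi) := by
  funext j
  by_cases hj : j = i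
  · subst hj
    funext h
    simp [toB, toB1]
  · funext h
    simp [toB, hj]

/-- Against stationary opponents every behavior strategy has a stationary strategy with
the same occupation measure. -/
lemma exists_stat_tStep_eq (hlam0 : 0 ≤ lam) (hlam1 : lam < 1) (x : G.StatProf) {i : G.I}
    (σi : G.BStrat i) : ∃ xi : G.Stat i,
      tStep lam s0 (Function.update (toB x) i σi) =
        tStep lam s0 (Function.update (toB x) i (toB1 xi)) := by
  obtain ⟨xi, hxi⟩ := exists_stat_actOcc (s0 := s0) (σ := Function.update (toB x) i σi)
    hlam0 hlam1 σi
  refine ⟨xi, ?_⟩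
  rw [← toB_update]
  refine tStep_eq_of_disintegration hlam0 hlam1 fun st => ?_
  rw [← Finset.mul_prod_erase _ _ (Finset.mem_univ i), Function.update_self, ← mul_assoc, ← hxi,
    actOcc, discSum, discSum, ← tsum_mul_right]
  refine tsum_congr fun h => ?_
  rw [pairProb_eq]
  split_ifs
  · rw [← Finset.mul_prod_erase _ _ (Finset.mem_univ i), Function.update_self, ← mul_assoc]
    congr 1
    refine Finset.prod_congr rfl fun j hj => ?_
    simp [Finset.ne_of_mem_erase hj, toB]
  · simp

/-! ### Bounds on the modified payoff -/

lemma sum_UD_of_partition {Di : Finset (Finset G.S)} (hDi : IsPartitionF Di) (i : G.I) :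
    ∑ D ∈ Di, UD lam s0 σ i D = payoffD lam s0 σ i := by
  simp only [UD, payoffD]
  rw [Finset.sum_comm]
  refine Finset.sum_congr rfl fun st _ => ?_
  obtain ⟨D, ⟨hD, hs⟩, huniq⟩ := hDi st.1
  rw [Finset.sum_eq_single_of_mem D hD, if_pos hs]
  intro D' hD' hne
  exact if_neg fun hs' => hne (huniq D' ⟨hD', hs'⟩)

lemma modPayoff_le_payoffD {Di : Finset (Finset G.S)} (hDi : IsPartitionF Di) (i : G.I)
    (c : Finset G.S → ℝ) : modPayoff lam s0 σ i Di c ≤ payoffD lam s0 σ i := by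
  rw [← sum_UD_of_partition hDi]
  exact Finset.sum_le_sum fun D _ => min_le_left _ _

lemma abs_sum_tStep_le (hlam0 : 0 ≤ lam) (hlam1 : lam < 1) {g : G.Step → ℝ}
    (hg : ∀ st, |g st| ≤ 1) :
    |∑ st, tStep lam s0 σ st * g st| ≤ Fintype.card G.Step := by
  refine (Finset.abs_sum_le_sum_abs _ _).trans ?_
  refine (Finset.sum_le_card_nsmul _ _ 1 fun st _ => ?_).trans (by simp)
  rw [abs_mul, abs_of_nonneg (tStep_nonneg hlam0 hlam1 st)]
  exact mul_le_one₀ (tStep_le_one hlam0 hlam1 st) (abs_nonneg _) (hg st)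

lemma abs_payoffD_le (hlam0 : 0 ≤ lam) (hlam1 : lam < 1) (i : G.I) :
    |payoffD lam s0 σ i| ≤ Fintype.card G.Step :=
  abs_sum_tStep_le hlam0 hlam1 fun st => G.u_bdd i st.1 st.2

lemma abs_UD_le (hlam0 : 0 ≤ lam) (hlam1 : lam < 1) (i : G.I) (D : Finset G.S) :
    |UD lam s0 σ i D| ≤ Fintype.card G.Step := by
  have h := abs_sum_tStep_le (s0 := s0) (σ := σ) hlam0 hlam1
    (g := fun st => if st.1 ∈ D then G.u i st.1 st.2 else 0) fun st => by
      split_ifs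
      exacts [G.u_bdd _ _ _, by simp]
  simpa only [UD, mul_ite, mul_zero] using h

lemma abs_tSet_le (hlam0 : 0 ≤ lam) (hlam1 : lam < 1) (D : Finset G.S) :
    |tSet lam s0 σ D| ≤ Fintype.card G.Step := by
  have h := abs_sum_tStep_le (s0 := s0) (σ := σ) hlam0 hlam1
    (g := fun st => if st.1 ∈ D then 1 else 0) fun st => by split_ifs <;> simp
  simpa only [tSet, mul_ite, mul_zero, mul_one] using h

lemma exists_le_modPayoff (hlam0 : 0 ≤ lam) (hlam1 : lam < 1) (s0 : G.S) (i : G.I)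
    (Di : Finset (Finset G.S)) (c : Finset G.S → ℝ) :
    ∃ B, ∀ σ : G.Profile, B ≤ modPayoff lam s0 σ i Di c := by
  refine ⟨∑ D ∈ Di, min (-(Fintype.card G.Step : ℝ)) (-(Fintype.card G.Step * |c D|)),
    fun σ => Finset.sum_le_sum fun D _ => min_le_min ?_ ?_⟩
  · exact neg_le_of_abs_le (abs_UD_le hlam0 hlam1 i D)
  · refine neg_le_of_abs_le ?_
    rw [abs_mul]
    exact mul_le_mul_of_nonneg_right (abs_tSet_le hlam0 hlam1 D) (abs_nonneg _)

lemma modPayoff_le_card (hlam0 : 0 ≤ lam) (hlam1 : lam < 1) {Di : Finset (Finset G.S)}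
    (hDi : IsPartitionF Di) (i : G.I) (c : Finset G.S → ℝ) :
    modPayoff lam s0 σ i Di c ≤ Fintype.card G.Step :=
  (modPayoff_le_payoffD hDi i c).trans (le_of_abs_le (abs_payoffD_le hlam0 hlam1 i))

/-! ### The Shapley operator -/

/-- The payoff of the one-shot game at the state `s` with continuation payoffs `w`. -/
def oneShot (lam : ℝ) (i : G.I) (w : G.S → ℝ) (s : G.S) (y : ∀ j, Mixed (G.A j s)) : ℝ :=
  ∑ a : G.Prof s, (∏ j, (y j).1 (a j)) *
    ((1 - lam) * G.u i s a + lam * ∑ s', G.q s a s' * w s')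

lemma sum_mul_le_of_le_add {α : Type*} [Fintype α] {p f g : α → ℝ} {C : ℝ} (hp : ∀ a, 0 ≤ p a)
    (hp1 : ∑ a, p a = 1) (h : ∀ a, f a ≤ g a + C) :
    ∑ a, p a * f a ≤ ∑ a, p a * g a + C := by
  calc ∑ a, p a * f a ≤ ∑ a, p a * (g a + C) :=
        Finset.sum_le_sum fun a _ => mul_le_mul_of_nonneg_left (h a) (hp a)
    _ = ∑ a, p a * g a + C := by
        simp only [mul_add, Finset.sum_add_distrib, ← Finset.sum_mul, hp1, one_mul]

lemma abs_sum_mul_le {α : Type*} [Fintype α] {p f : α → ℝ} {C : ℝ} (hp : ∀ a, 0 ≤ p a)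
    (hp1 : ∑ a, p a = 1) (h : ∀ a, |f a| ≤ C) : |∑ a, p a * f a| ≤ C := by
  have h1 := sum_mul_le_of_le_add (g := fun _ => 0) hp hp1
    fun a => (le_of_abs_le (h a)).trans (zero_add C).ge
  have h2 := sum_mul_le_of_le_add (f := fun _ => 0) (g := f) (C := C) hp hp1
    fun a => by linarith [neg_le_of_abs_le (h a)]
  simp only [mul_zero, Finset.sum_const_zero, zero_add] at h1 h2
  exact abs_le.2 ⟨by linarith, h1⟩

lemma abs_stagePay_le (i : G.I) (h : G.Hist) : |stagePay σ i h| ≤ 1 :=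
  abs_sum_mul_le (actProb_nonneg σ h) (sum_actProb σ h) fun a => G.u_bdd i h.2 a

lemma abs_nextVal_le (w : G.S → ℝ) (h : G.Hist) : |nextVal σ w h| ≤ ‖w‖ :=
  abs_sum_mul_le (actProb_nonneg σ h) (sum_actProb σ h) fun a =>
    abs_sum_mul_le (G.q_nonneg h.2 a) (G.q_sum h.2 a) fun s => norm_le_pi_norm w s

lemma oneShot_eq (i : G.I) (w : G.S → ℝ) (h : G.Hist) :
    oneShot lam i w h.2 (fun j => σ j h) = (1 - lam) * stagePay σ i h + lam * nextVal σ w h := by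
  simp only [oneShot, stagePay, nextVal, Finset.mul_sum (s := (Finset.univ : Finset (G.Prof h.2))),
    ← Finset.sum_add_distrib, actProb]
  exact Finset.sum_congr rfl fun a _ => by ring

lemma oneShot_le_add (hlam0 : 0 ≤ lam) (i : G.I) (w w' : G.S → ℝ) (s : G.S)
    (y : ∀ j, Mixed (G.A j s)) :
    oneShot lam i w s y ≤ oneShot lam i w' s y + lam * dist w w' := by
  refine sum_mul_le_of_le_add (fun a => Finset.prod_nonneg fun j _ => (y j).2.1 _)
    (sum_prod_mixed y) fun a => ?_
  have h : ∑ s', G.q s a s' * w s' ≤ ∑ s', G.q s a s' * w' s' + dist w w' :=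
    sum_mul_le_of_le_add (G.q_nonneg s a) (G.q_sum s a) fun s' => by
      have := (le_abs_self _).trans (dist_le_pi_dist w w' s')
      linarith
  nlinarith [mul_le_mul_of_nonneg_left h hlam0]

lemma abs_oneShot_le (hlam0 : 0 ≤ lam) (hlam1 : lam < 1) (i : G.I) (w : G.S → ℝ) (s : G.S)
    (y : ∀ j, Mixed (G.A j s)) : |oneShot lam i w s y| ≤ 1 + ‖w‖ := by
  refine abs_sum_mul_le (fun a => Finset.prod_nonneg fun j _ => (y j).2.1 _)
    (sum_prod_mixed y) fun a => ?_
  have h1 : |(1 - lam) * G.u i s a| ≤ 1 := by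
    rw [abs_mul, abs_of_pos (by linarith)]
    exact mul_le_one₀ (by linarith) (abs_nonneg _) (G.u_bdd i s a)
  have h2 : |lam * ∑ s', G.q s a s' * w s'| ≤ ‖w‖ := by
    rw [abs_mul, abs_of_nonneg hlam0]
    have := abs_sum_mul_le (G.q_nonneg s a) (G.q_sum s a) fun s' => norm_le_pi_norm w s'
    exact (mul_le_of_le_one_left (abs_nonneg _) hlam1.le).trans this
  exact (abs_add_le _ _).trans (add_le_add h1 h2)

instance Mixed.instNonempty {α : Type} [Fintype α] [Nonempty α] : Nonempty (Mixed α) := by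
  classical
  obtain ⟨a⟩ := ‹Nonempty α›
  exact ⟨⟨Pi.single a 1, fun b => by
    by_cases hb : b = a
    · subst hb; simp
    · simp [hb], by simp⟩⟩

/-- The Shapley operator for the min-max value of player `i`. -/
noncomputable def shapley (lam : ℝ) (i : G.I) (w : G.S → ℝ) (s : G.S) : ℝ :=
  ⨅ y : (∀ j, Mixed (G.A j s)), ⨆ b : Mixed (G.A i s), oneShot lam i w s (Function.update y i b)

lemma bddAbove_oneShot (hlam0 : 0 ≤ lam) (hlam1 : lam < 1) (i : G.I) (w : G.S → ℝ) (s : G.S)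
    (y : ∀ j, Mixed (G.A j s)) :
    BddAbove (Set.range fun b : Mixed (G.A i s) => oneShot lam i w s (Function.update y i b)) :=
  ⟨1 + ‖w‖, Set.forall_mem_range.2 fun _ => le_of_abs_le (abs_oneShot_le hlam0 hlam1 i w s _)⟩

lemma bddBelow_iSup_oneShot (hlam0 : 0 ≤ lam) (hlam1 : lam < 1) (i : G.I) (w : G.S → ℝ)
    (s : G.S) :
    BddBelow (Set.range fun y : (∀ j, Mixed (G.A j s)) =>
      ⨆ b : Mixed (G.A i s), oneShot lam i w s (Function.update y i b)) :=
  ⟨-(1 + ‖w‖), Set.forall_mem_range.2 fun y =>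
    (neg_le_of_abs_le (abs_oneShot_le hlam0 hlam1 i w s _)).trans
      (le_ciSup (bddAbove_oneShot hlam0 hlam1 i w s y) (y i))⟩

lemma shapley_le_add (hlam0 : 0 ≤ lam) (hlam1 : lam < 1) (i : G.I) (w w' : G.S → ℝ) (s : G.S) :
    shapley lam i w s ≤ shapley lam i w' s + lam * dist w w' := by
  rw [← sub_le_iff_le_add]
  refine le_ciInf fun y => ?_
  rw [sub_le_iff_le_add]
  refine (ciInf_le (bddBelow_iSup_oneShot hlam0 hlam1 i w s) y).trans (ciSup_le fun b => ?_)
  refine (oneShot_le_add hlam0 i w w' s _).trans ?_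
  gcongr
  exact le_ciSup (bddAbove_oneShot hlam0 hlam1 i w' s y) b

lemma exists_shapley_fixedPoint (hlam0 : 0 ≤ lam) (hlam1 : lam < 1) (i : G.I) :
    ∃ w : G.S → ℝ, shapley lam i w = w := by
  have hc : ContractingWith ⟨lam, hlam0⟩ (shapley (G := G) lam i) := by
    refine ⟨hlam1, LipschitzWith.of_dist_le_mul fun w w' => ?_⟩
    refine (dist_pi_le_iff (mul_nonneg hlam0 dist_nonneg)).2 fun s => ?_
    rw [Real.dist_eq, abs_sub_le_iff]
    have h1 := shapley_le_add hlam0 hlam1 i w w' s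
    have h2 := shapley_le_add hlam0 hlam1 i w' w s
    rw [dist_comm w' w] at h2
    exact ⟨by simpa using sub_le_iff_le_add'.2 h1, by simpa using sub_le_iff_le_add'.2 h2⟩
  exact ⟨_, hc.fixedPoint_isFixedPt⟩

/-- The discounted payoff is the continuation value `w` at the initial state corrected by the
discounted one-shot gains along the play. -/
lemma payoffD_eq_add_discSum (hlam0 : 0 ≤ lam) (hlam1 : lam < 1) (i : G.I) (w : G.S → ℝ) :
    payoffD lam s0 σ i =
      w s0 + discSum lam s0 σ (fun h => oneShot lam i w h.2 (fun j => σ j h) - w h.2) := by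
  have hst := (summable_weight_mul (s0 := s0) (σ := σ) hlam0 hlam1
    (abs_stagePay_le (σ := σ) i)).mul_left (1 - lam)
  have hnv := (summable_weight_mul (s0 := s0) (σ := σ) hlam0 hlam1
    (abs_nextVal_le (σ := σ) w)).mul_left lam
  have hw := summable_weight_mul (s0 := s0) (σ := σ) hlam0 hlam1
    (φ := fun h => w h.2) fun h => norm_le_pi_norm w h.2
  have h1 := payoffD_eq_discSum (s0 := s0) (σ := σ) hlam0 hlam1 i
  have h2 := discSum_state (s0 := s0) (σ := σ) hlam0 hlam1 w
  have h3 : discSum lam s0 σ (fun h => oneShot lam i w h.2 (fun j => σ j h) - w h.2) =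
      (1 - lam) * discSum lam s0 σ (stagePay σ i) + lam * discSum lam s0 σ (nextVal σ w) -
        discSum lam s0 σ (fun h => w h.2) := by
    simp only [discSum, ← tsum_mul_left]
    rw [← hst.tsum_add hnv, ← (hst.add hnv).tsum_sub hw]
    refine tsum_congr fun h => ?_
    rw [oneShot_eq]
    ring
  linarith

lemma abs_oneShot_sub_le (hlam0 : 0 ≤ lam) (hlam1 : lam < 1) (i : G.I) (w : G.S → ℝ)
    (h : G.Hist) : |oneShot lam i w h.2 (fun j => σ j h) - w h.2| ≤ 1 + ‖w‖ + ‖w‖ :=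
  (abs_sub _ _).trans
    (add_le_add (abs_oneShot_le hlam0 hlam1 i w h.2 _) (norm_le_pi_norm w h.2))

lemma payoffD_le_of_oneShot_le (hlam0 : 0 ≤ lam) (hlam1 : lam < 1) (i : G.I) {w : G.S → ℝ}
    {ε : ℝ} (h : ∀ h : G.Hist, oneShot lam i w h.2 (fun j => σ j h) ≤ w h.2 + ε) :
    payoffD lam s0 σ i ≤ w s0 + ε / (1 - lam) := by
  rw [payoffD_eq_add_discSum hlam0 hlam1 i w, ← discSum_const (s0 := s0) (σ := σ) hlam0 hlam1 ε]
  gcongr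
  exact discSum_mono hlam0 hlam1 (abs_oneShot_sub_le hlam0 hlam1 i w) (fun _ => le_rfl)
    fun k => by linarith [h k]

lemma le_payoffD_of_le_oneShot (hlam0 : 0 ≤ lam) (hlam1 : lam < 1) (i : G.I) {w : G.S → ℝ}
    {ε : ℝ} (h : ∀ h : G.Hist, w h.2 + ε ≤ oneShot lam i w h.2 (fun j => σ j h)) :
    w s0 + ε / (1 - lam) ≤ payoffD lam s0 σ i := by
  rw [payoffD_eq_add_discSum hlam0 hlam1 i w, ← discSum_const (s0 := s0) (σ := σ) hlam0 hlam1 ε]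
  gcongr
  exact discSum_mono hlam0 hlam1 (fun _ => le_rfl) (abs_oneShot_sub_le hlam0 hlam1 i w)
    fun k => by linarith [h k]

lemma update_apply_hist {i : G.I} (σi : G.BStrat i) (h : G.Hist) :
    (fun j => Function.update σ i σi j h) = Function.update (fun j => σ j h) i (σi h) := by
  funext j
  by_cases hj : j = i
  · subst hj
    simp
  · simp [hj]

/-- Up to any error, the opponents have a stationary profile holding player `i` down to the
fixed point of the Shapley operator. -/
lemma exists_stat_payoffD_le (hlam0 : 0 ≤ lam) (hlam1 : lam < 1) (i : G.I) {w : G.S → ℝ}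
    (hw : shapley lam i w = w) {ε : ℝ} (hε : 0 < ε) :
    ∃ x : G.StatProf, ∀ (s0 : G.S) (σi : G.BStrat i),
      payoffD lam s0 (Function.update (toB x) i σi) i ≤ w s0 + ε / (1 - lam) := by
  have key : ∀ s, ∃ y : (∀ j, Mixed (G.A j s)),
      ⨆ b : Mixed (G.A i s), oneShot lam i w s (Function.update y i b) < w s + ε := fun s =>
    exists_lt_of_ciInf_lt ((congrFun hw s).trans_lt (lt_add_of_pos_right _ hε))
  choose y hy using key
  refine ⟨fun j s => y s j, fun s0 σi => payoffD_le_of_oneShot_le hlam0 hlam1 i fun h => ?_⟩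
  rw [update_apply_hist]
  exact (le_ciSup (bddAbove_oneShot hlam0 hlam1 i w h.2 (y h.2)) (σi h)).trans (hy h.2).le

/-- Up to any error, player `i` has a reply guaranteeing the fixed point of the Shapley
operator. -/
lemma exists_le_payoffD (hlam0 : 0 ≤ lam) (hlam1 : lam < 1) (i : G.I) {w : G.S → ℝ}
    (hw : shapley lam i w = w) {ε : ℝ} (hε : 0 < ε) (s0 : G.S) (σ : G.Profile) :
    ∃ σi : G.BStrat i, w s0 + -ε / (1 - lam) ≤ payoffD lam s0 (Function.update σ i σi) i := by
  have key : ∀ h : G.Hist, ∃ b : Mixed (G.A i h.2),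
      w h.2 + -ε < oneShot lam i w h.2 (Function.update (fun j => σ j h) i b) := fun h =>
    exists_lt_of_lt_ciSup <| (add_lt_of_neg_right _ (neg_lt_zero.2 hε)).trans_le <|
      (congrFun hw h.2).ge.trans (ciInf_le (bddBelow_iSup_oneShot hlam0 hlam1 i w h.2) _)
  choose σi hσi using key
  refine ⟨σi, le_payoffD_of_le_oneShot hlam0 hlam1 i fun h => ?_⟩
  rw [update_apply_hist]
  exact (hσi h).le

/-! ### Comparison of the min-max values -/

variable {Di : Finset (Finset G.S)}

lemma bddAbove_modPayoff (hlam0 : 0 ≤ lam) (hlam1 : lam < 1) (hDi : IsPartitionF Di) (i : G.I)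
    (c : Finset G.S → ℝ) {ι : Type*} (τ : ι → G.Profile) :
    BddAbove (Set.range fun k => modPayoff lam s0 (τ k) i Di c) :=
  ⟨_, Set.forall_mem_range.2 fun _ => modPayoff_le_card hlam0 hlam1 hDi i c⟩

lemma bddBelow_iSup_modPayoff (hlam0 : 0 ≤ lam) (hlam1 : lam < 1) (hDi : IsPartitionF Di)
    (i : G.I) (c : Finset G.S → ℝ) {ι κ : Type*} [Nonempty κ] (τ : ι → κ → G.Profile) :
    BddBelow (Set.range fun k => ⨆ l, modPayoff lam s0 (τ k l) i Di c) := by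
  obtain ⟨B, hB⟩ := exists_le_modPayoff hlam0 hlam1 s0 i Di c
  exact ⟨B, Set.forall_mem_range.2 fun k => (hB _).trans
    (le_ciSup (bddAbove_modPayoff hlam0 hlam1 hDi i c (τ k)) (Classical.arbitrary κ))⟩

lemma minmaxMod_le_minmaxModStat (hlam0 : 0 ≤ lam) (hlam1 : lam < 1) (hDi : IsPartitionF Di)
    (i : G.I) (c : Finset G.S → ℝ) :
    minmaxMod G lam s0 i Di c ≤ minmaxModStat G lam s0 i Di c := by
  refine le_ciInf fun x => ?_
  refine (ciInf_le (bddBelow_iSup_modPayoff hlam0 hlam1 hDi i c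
    fun (σ : G.Profile) (σi : G.BStrat i) => Function.update σ i σi) (toB x)).trans
    (ciSup_le fun σi => ?_)
  obtain ⟨xi, hxi⟩ := exists_stat_tStep_eq (s0 := s0) hlam0 hlam1 x σi
  have heq : modPayoff lam s0 (Function.update (toB x) i σi) i Di c =
      modPayoff lam s0 (Function.update (toB x) i (toB1 xi)) i Di c := by
    simp only [modPayoff, UD, tSet, hxi]
  rw [heq]
  exact le_ciSup (bddAbove_modPayoff hlam0 hlam1 hDi i c
    fun xi : G.Stat i => Function.update (toB x) i (toB1 xi)) xi

lemma minmaxModStat_le_minmaxOrig (hlam0 : 0 ≤ lam) (hlam1 : lam < 1) (hDi : IsPartitionF Di)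
    (i : G.I) (c : Finset G.S → ℝ) :
    minmaxModStat G lam s0 i Di c ≤ minmaxOrig G lam s0 i := by
  have hpos : 0 < 1 - lam := by linarith
  obtain ⟨w, hw⟩ := exists_shapley_fixedPoint (G := G) hlam0 hlam1 i
  have hstat : minmaxModStat G lam s0 i Di c ≤ w s0 := by
    refine le_of_forall_pos_le_add fun ε hε => ?_
    obtain ⟨x, hx⟩ := exists_stat_payoffD_le hlam0 hlam1 i hw (mul_pos hε hpos)
    refine (ciInf_le (bddBelow_iSup_modPayoff hlam0 hlam1 hDi i c
      fun (x : G.StatProf) (xi : G.Stat i) => Function.update (toB x) i (toB1 xi)) x).trans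
      (ciSup_le fun xi => (modPayoff_le_payoffD hDi i c).trans ?_)
    simpa [hpos.ne'] using hx s0 (toB1 xi)
  refine hstat.trans (le_ciInf fun σ => le_of_forall_pos_le_add fun ε hε => ?_)
  obtain ⟨σi, hσi⟩ := exists_le_payoffD hlam0 hlam1 i hw (mul_pos hε hpos) s0 σ
  have hbdd : BddAbove (Set.range fun σi : G.BStrat i =>
      payoffD lam s0 (Function.update σ i σi) i) :=
    ⟨_, Set.forall_mem_range.2 fun _ => le_of_abs_le (abs_payoffD_le hlam0 hlam1 i)⟩
  rw [neg_div, mul_div_cancel_right₀ _ hpos.ne'] at hσi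
  linarith [le_ciSup hbdd σi]

end StocGame

open StocGame in
/-- the min-max value of the modified game is at most its min-max value in
stationary strategies, which is at most the `lam`-discounted min-max value of the
original game. -/
theorem stmt_13 (G : StocGame) (lam : ℝ) (hlam0 : 0 ≤ lam) (hlam1 : lam < 1) (s0 : G.S)
    (i : G.I) (Di : Finset (Finset G.S)) (hDi : IsPartitionF Di)
    (c : Finset G.S → ℝ) :
    minmaxMod G lam s0 i Di c ≤ minmaxModStat G lam s0 i Di c ∧
      minmaxModStat G lam s0 i Di c ≤ minmaxOrig G lam s0 i := by
  exact ⟨minmaxMod_le_minmaxModStat hlam0 hlam1 hDi i c,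
    minmaxModStat_le_minmaxOrig hlam0 hlam1 hDi i c⟩
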